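/- (Gaussian-sum upper bound for sub-inverse-Gaussian solutions.) Fix κ₀ ∈ (0,1], λ > 0, and c₂ ≥ 0. There exists a constant C, depending only on κ₀, λ, and c₂, such that the following holds. Let φ : [0,1]×ℝ → ℝ be continuous, positive and C¹ in t and C² in x on (0,1]×ℝ, satisfying ∂_t φ = κ(−∂_x φ/(λφ)) ∂_x² φ + λ c₂ φ pointwise on (0,1]×ℝ, where κ : ℝ → ℝ is continuous with values in [κ₀, κ₀⁻¹]. Suppose there exist K > 0 and α < 2 with 0 ≤ φ(t,x) ≤ K e^{K|x|^α} for all (t,x) ∈ [0,1]×ℝ. For j ∈ ℤ set φ_j := sup_{y∈[j,j+1]} φ(0,y). Then for every t ∈ [0,1] and x ∈ ℝ, φ(t,x) ≤ C ∑_{j∈ℤ} φ_j e^{−C⁻¹ (x−j−1/2)²}. -/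

import Mathlib

open Real Set

noncomputable section

/-- Partial derivative in time. -/
def pdT (u : ℝ → ℝ → ℝ) (t x : ℝ) : ℝ := deriv (fun s => u s x) t

/-- Partial derivative in space. -/
def pdX (u : ℝ → ℝ → ℝ) (t x : ℝ) : ℝ := deriv (fun y => u t y) x

/-- Second partial derivative in space. -/
def pdXX (u : ℝ → ℝ → ℝ) (t x : ℝ) : ℝ := deriv (fun y => pdX u t y) x

/-- The Gaussian profile `exp (k (x - m)² / (4 (σ - t)))`, a decaying heat profile for `σ < t`
and a growing one for `t < σ`. -/
def gaussianProfile (k σ m t x : ℝ) : ℝ := exp (k * (x - m) ^ 2 / (4 * (σ - t)))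

lemma gaussianProfile_pos (k σ m t x : ℝ) : 0 < gaussianProfile k σ m t x := exp_pos _

lemma hasDerivAt_gaussianProfile_time (k σ m x : ℝ) {t : ℝ} (h : σ - t ≠ 0) :
    HasDerivAt (fun s => gaussianProfile k σ m s x)
      (gaussianProfile k σ m t x * (k * (x - m) ^ 2 / (4 * (σ - t) ^ 2))) t := by
  have h1 : HasDerivAt (fun s : ℝ => 4 * (σ - s)) (4 * (-1)) t :=
    ((hasDerivAt_id t).const_sub σ).const_mul 4
  have h2 := ((hasDerivAt_const t (k * (x - m) ^ 2)).div h1 (by simpa using h)).exp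
  convert h2 using 1
  simp only [gaussianProfile, Pi.div_apply]
  congr 1
  field_simp
  ring

lemma hasDerivAt_gaussianProfile_space (k σ m t x : ℝ) :
    HasDerivAt (fun y => gaussianProfile k σ m t y)
      (gaussianProfile k σ m t x * (k * (x - m) / (2 * (σ - t)))) x := by
  have h2 := (((((hasDerivAt_id x).sub_const m).pow 2).const_mul k).div_const (4 * (σ - t))).exp
  convert h2 using 1
  simp only [gaussianProfile, Pi.pow_apply, id]
  congr 1
  simp only [div_eq_mul_inv, mul_inv]
  norm_num
  ring

lemma hasDerivAt_gaussianProfile_space_two (k σ m t x : ℝ) :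
    HasDerivAt (fun y => gaussianProfile k σ m t y * (k * (y - m) / (2 * (σ - t))))
      (gaussianProfile k σ m t x *
        (k ^ 2 * (x - m) ^ 2 / (4 * (σ - t) ^ 2) + k / (2 * (σ - t)))) x := by
  have h1 := (((hasDerivAt_id x).sub_const m).const_mul k).div_const (2 * (σ - t))
  have h2 := (hasDerivAt_gaussianProfile_space k σ m t x).mul h1
  refine h2.congr_deriv ?_
  simp only [id]
  generalize σ - t = r
  ring

/-- Gaussian profiles are supersolutions, up to a zeroth-order term, of `∂ₜ - a ∂ₓ²`
whenever `0 ≤ a ≤ k⁻¹`. -/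
lemma gaussianProfile_supersolution {k a : ℝ} (hk : 0 < k) (hak : a * k ≤ 1) (σ m t x : ℝ) :
    a * (gaussianProfile k σ m t x *
        (k ^ 2 * (x - m) ^ 2 / (4 * (σ - t) ^ 2) + k / (2 * (σ - t)))) ≤
      gaussianProfile k σ m t x * (k * (x - m) ^ 2 / (4 * (σ - t) ^ 2)) +
        gaussianProfile k σ m t x * (a * k / (2 * (σ - t))) := by
  have h : a * (k ^ 2 * (x - m) ^ 2 / (4 * (σ - t) ^ 2)) ≤
      k * (x - m) ^ 2 / (4 * (σ - t) ^ 2) := by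
    have h0 : 0 ≤ k * (x - m) ^ 2 / (4 * (σ - t) ^ 2) := by positivity
    calc _ = (a * k) * (k * (x - m) ^ 2 / (4 * (σ - t) ^ 2)) := by ring
      _ ≤ 1 * (k * (x - m) ^ 2 / (4 * (σ - t) ^ 2)) := by gcongr
      _ = _ := one_mul _
  have := mul_le_mul_of_nonneg_left h (gaussianProfile_pos k σ m t x).le
  calc _ = gaussianProfile k σ m t x * (a * (k ^ 2 * (x - m) ^ 2 / (4 * (σ - t) ^ 2))) +
        gaussianProfile k σ m t x * (a * k / (2 * (σ - t))) := by ring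
    _ ≤ _ := by gcongr

lemma continuousOn_gaussianProfile (k m : ℝ) {σ : ℝ} {s : Set (ℝ × ℝ)}
    (h : ∀ p ∈ s, σ - p.1 ≠ 0) :
    ContinuousOn (fun p : ℝ × ℝ => gaussianProfile k σ m p.1 p.2) s := by
  unfold gaussianProfile
  refine continuous_exp.comp_continuousOn (ContinuousOn.div (by fun_prop) (by fun_prop) ?_)
  intro p hp
  simpa using h p hp

lemma nonpos_of_isLocalMax_of_hasDerivAt {f f' : ℝ → ℝ} {f'' x : ℝ}
    (hf : ∀ y, HasDerivAt f (f' y) y) (hf' : HasDerivAt f' f'' x) (hx : IsLocalMax f x) :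
    f'' ≤ 0 := by
  by_contra! hpos
  have hd : deriv f = f' := funext fun y => (hf y).deriv
  have hmin : IsLocalMin f x := isLocalMin_of_deriv_deriv_pos (by rwa [hd, hf'.deriv])
    hx.deriv_eq_zero (hf x).continuousAt
  have hconst : f =ᶠ[nhds x] fun _ => f x := by
    filter_upwards [hx, hmin] with y h1 h2 using le_antisymm h1 h2
  have h0 := hconst.deriv.deriv_eq
  rw [hd, hf'.deriv] at h0
  simp at h0
  exact hpos.ne' h0

lemma nonneg_of_hasDerivAt_of_forall_le {f : ℝ → ℝ} {f' a t : ℝ} (hat : a < t)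
    (hf : HasDerivAt f f' t) (hmax : ∀ s ∈ Ioo a t, f s ≤ f t) : 0 ≤ f' := by
  have h := (hasDerivAt_iff_tendsto_slope.1 hf).mono_left
    (nhdsWithin_mono t (fun s (hs : s ∈ Iio t) => ne_of_lt hs))
  refine ge_of_tendsto h ?_
  filter_upwards [Ioo_mem_nhdsLT hat] with s hs
  rw [slope_def_field]
  exact div_nonneg_of_nonpos (sub_nonpos.2 (hmax s hs)) (sub_nonpos.2 hs.2.le)

/-- Weak maximum principle for strict subsolutions of `∂ₜ u = a ∂ₓ² u` on a rectangle. -/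
lemma nonpos_of_strict_subsolution {u ut ux uxx a : ℝ → ℝ → ℝ} {T L : ℝ}
    (hu : ContinuousOn (fun p : ℝ × ℝ => u p.1 p.2) (Icc 0 T ×ˢ Icc (-L) L))
    (ha : ∀ t x, 0 ≤ a t x)
    (ht : ∀ t ∈ Ioc 0 T, ∀ x, HasDerivAt (fun s => u s x) (ut t x) t)
    (hx : ∀ t ∈ Ioc 0 T, ∀ x, HasDerivAt (u t) (ux t x) x)
    (hxx : ∀ t ∈ Ioc 0 T, ∀ x, HasDerivAt (ux t) (uxx t x) x)
    (hsub : ∀ t ∈ Ioc 0 T, ∀ x, ut t x < a t x * uxx t x)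
    (hinit : ∀ x ∈ Icc (-L) L, u 0 x ≤ 0)
    (hleft : ∀ t ∈ Icc 0 T, u t (-L) ≤ 0) (hright : ∀ t ∈ Icc 0 T, u t L ≤ 0) :
    ∀ t ∈ Icc 0 T, ∀ x ∈ Icc (-L) L, u t x ≤ 0 := by
  intro t htT x hxL
  obtain ⟨⟨t₀, x₀⟩, ⟨ht₀, hx₀⟩, hmax⟩ :=
    (isCompact_Icc.prod isCompact_Icc).exists_isMaxOn ⟨(t, x), htT, hxL⟩ hu
  simp only at ht₀ hx₀
  have hmax' : ∀ s ∈ Icc 0 T, ∀ y ∈ Icc (-L) L, u s y ≤ u t₀ x₀ :=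
    fun s hs y hy => hmax (show (s, y) ∈ _ from ⟨hs, hy⟩)
  refine (hmax' t htT x hxL).trans ?_
  by_contra! hpos
  have ht0 : 0 < t₀ := by
    refine lt_of_le_of_ne ht₀.1 ?_
    rintro rfl
    exact (hinit x₀ hx₀).not_gt hpos
  have hxl : -L < x₀ := by
    refine lt_of_le_of_ne hx₀.1 ?_
    rintro rfl
    exact (hleft t₀ ht₀).not_gt hpos
  have hxr : x₀ < L := by
    refine lt_of_le_of_ne hx₀.2 ?_
    rintro rfl
    exact (hright t₀ ht₀).not_gt hpos
  have hmem : t₀ ∈ Ioc 0 T := ⟨ht0, ht₀.2⟩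
  have h1 : 0 ≤ ut t₀ x₀ := nonneg_of_hasDerivAt_of_forall_le ht0 (ht t₀ hmem x₀)
    fun s hs => hmax' s ⟨hs.1.le, hs.2.le.trans ht₀.2⟩ x₀ hx₀
  have h2 : uxx t₀ x₀ ≤ 0 := by
    refine nonpos_of_isLocalMax_of_hasDerivAt (hx t₀ hmem) (hxx t₀ hmem x₀) ?_
    filter_upwards [Icc_mem_nhds hxl hxr] with y hy using hmax' t₀ ht₀ y hy
  have h3 := hsub t₀ hmem x₀
  nlinarith [mul_nonneg (ha t₀ x₀) (neg_nonneg.2 h2)]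

/-- Sub-inverse-Gaussian growth is dominated by `exp (ε x²)` for every `ε > 0`. -/
lemma exists_le_mul_exp_sq {φ : ℝ → ℝ → ℝ} {K α ε : ℝ} (hK : 0 < K) (hα : α < 2) (hε : 0 < ε)
    (hφ : ContinuousOn (fun p : ℝ × ℝ => φ p.1 p.2) (Icc 0 1 ×ˢ (univ : Set ℝ)))
    (hle : ∀ t ∈ Icc (0:ℝ) 1, ∀ x : ℝ, φ t x ≤ K * exp (K * |x| ^ α)) :
    ∃ M : ℝ, 0 < M ∧ ∀ t ∈ Icc (0:ℝ) 1, ∀ x : ℝ, φ t x ≤ M * exp (ε * x ^ 2) := by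
  obtain ⟨R, hR⟩ := Filter.eventually_atTop.1
    (((tendsto_rpow_neg_atTop (sub_pos.2 hα)).eventually_lt_const (div_pos hε hK)).and
      (Filter.eventually_gt_atTop 0))
  obtain ⟨B, hB⟩ := ((isCompact_Icc (a := (0:ℝ)) (b := 1)).prod
    (isCompact_Icc (a := -R) (b := R))).exists_bound_of_continuousOn
    (hφ.mono (prod_mono_right (subset_univ _)))
  refine ⟨max K B, lt_max_of_lt_left hK, fun t ht x => ?_⟩
  have h1 : 1 ≤ exp (ε * x ^ 2) := one_le_exp (by positivity)
  rcases le_total R |x| with h | h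
  · refine (hle t ht x).trans ?_
    obtain ⟨h2, h3⟩ := hR _ h
    have h4 : K * |x| ^ α ≤ ε * x ^ 2 := by
      calc K * |x| ^ α = K * (|x| ^ (-(2 - α)) * x ^ 2) := by
            rw [← sq_abs x, ← rpow_two, ← rpow_add h3]
            ring_nf
        _ ≤ K * (ε / K * x ^ 2) := by gcongr
        _ = ε * x ^ 2 := by field_simp
    exact mul_le_mul (le_max_left _ _) (exp_le_exp.2 h4) (exp_pos _).le
      (hK.le.trans (le_max_left _ _))
  · calc φ t x ≤ B := (le_abs_self _).trans (hB (t, x) ⟨ht, abs_le.1 h⟩)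
      _ ≤ max K B * 1 := by simp
      _ ≤ _ := by gcongr

lemma summable_exp_neg_mul_int_sub_sq {c : ℝ} (hc : 0 < c) (x : ℝ) :
    Summable fun j : ℤ => exp (-c * (x - j - 1/2) ^ 2) := by
  have h := ((Real.summable_one_div_int_add_rpow (1/2 - x) 2).2 one_lt_two).mul_left c⁻¹
  refine h.of_norm_bounded_eventually ?_
  have hfin : {j : ℤ | (j : ℝ) + (1/2 - x) = 0}.Finite := by
    refine Set.Subsingleton.finite fun i hi j hj => ?_
    rw [mem_ofPred_eq] at hi hj
    exact_mod_cast (by linarith : (i : ℝ) = j)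
  filter_upwards [hfin.compl_mem_cofinite] with j hj
  have hj' : (j : ℝ) + (1/2 - x) ≠ 0 := hj
  have hpos : 0 < c * ((j : ℝ) + (1/2 - x)) ^ 2 := by positivity
  rw [norm_of_nonneg (exp_pos _).le, rpow_two, sq_abs, neg_mul, exp_neg,
    one_div (((j : ℝ) + (1/2 - x)) ^ 2), ← mul_inv]
  refine inv_anti₀ hpos ?_
  rw [show x - j - 1/2 = -((j : ℝ) + (1/2 - x)) by ring, neg_sq]
  linarith [add_one_le_exp (c * ((j : ℝ) + (1/2 - x)) ^ 2)]

lemma summable_sSup_mul_exp {f : ℝ → ℝ} {M c : ℝ} (hc : 0 < c) (hM : 0 < M)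
    (h0 : ∀ x, 0 ≤ f x) (hle : ∀ x, f x ≤ M * exp (c / 4 * x ^ 2)) (x : ℝ) :
    Summable fun j : ℤ =>
      sSup (f '' Icc (j : ℝ) (j + 1)) * exp (-c * (x - j - 1/2) ^ 2) := by
  have hs := (summable_exp_neg_mul_int_sub_sq (half_pos hc) x).mul_left
    (M * exp (c / 2 * (|x| + 1/2) ^ 2))
  refine hs.of_nonneg_of_le (fun j => ?_) (fun j => ?_)
  · exact mul_nonneg (Real.sSup_nonneg (by rintro _ ⟨y, -, rfl⟩; exact h0 y)) (exp_pos _).le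
  · have hsup : sSup (f '' Icc (j : ℝ) (j + 1)) ≤
        M * exp (c / 2 * (x - j - 1/2) ^ 2 + c / 2 * (|x| + 1/2) ^ 2) := by
      refine csSup_le (Set.Nonempty.image _ ⟨(j : ℝ), by simp⟩) ?_
      rintro _ ⟨y, hy, rfl⟩
      refine (hle y).trans ?_
      gcongr
      have h1 : |x + (y - j - 1/2)| ≤ |x| + 1/2 :=
        (abs_add_le _ _).trans (add_le_add le_rfl
          (abs_le.2 ⟨by linarith [hy.1], by linarith [hy.2]⟩))
      have h2 : (x + (y - j - 1/2)) ^ 2 ≤ (|x| + 1/2) ^ 2 := by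
        rw [← sq_abs]; gcongr
      have h3 : y ^ 2 ≤ 2 * (x - j - 1/2) ^ 2 + 2 * (|x| + 1/2) ^ 2 := by
        nlinarith [sq_nonneg ((x + (y - j - 1/2)) + (x - j - 1/2))]
      nlinarith
    calc _ ≤ M * exp (c / 2 * (x - j - 1/2) ^ 2 + c / 2 * (|x| + 1/2) ^ 2) *
          exp (-c * (x - j - 1/2) ^ 2) := by gcongr
      _ = _ := by
        rw [mul_assoc, ← exp_add, mul_assoc, ← exp_add]
        congr 2
        ring

/-- Comparison of a solution, at times before the terminal one, with a finite sum of decaying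
profiles fitted to the initial data, up to a small multiple of a growing profile. -/
lemma exp_neg_mul_le_sum_gaussianProfile_of_lt_one {k c M : ℝ} {a φ : ℝ → ℝ → ℝ} (hk : 0 < k)
    (hk1 : k ≤ 1) (hc : 0 ≤ c) (ha : ∀ t x, a t x ∈ Icc k k⁻¹)
    (hcont : ContinuousOn (fun p : ℝ × ℝ => φ p.1 p.2) (Icc 0 1 ×ˢ (univ : Set ℝ)))
    (hdt : ∀ x : ℝ, ContDiffOn ℝ 1 (fun s => φ s x) (Ioc 0 1))
    (hdx : ∀ t ∈ Ioc (0:ℝ) 1, ContDiff ℝ 2 (fun y => φ t y))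
    (heq : ∀ t ∈ Ioc (0:ℝ) 1, ∀ x : ℝ, pdT φ t x = a t x * pdXX φ t x + c * φ t x)
    (hnonneg : ∀ t ∈ Icc (0:ℝ) 1, ∀ x : ℝ, 0 ≤ φ t x)
    (hgrow : ∀ t ∈ Icc (0:ℝ) 1, ∀ x : ℝ, φ t x ≤ M * exp (k / 16 * x ^ 2))
    (hφ₀ : Continuous (φ 0)) {T : ℝ} (hT : T ∈ Ico (0:ℝ) 1) (x₁ : ℝ) :
    ∀ δ > 0, ∃ s : Finset ℤ, exp (-c * T) * φ T x₁ ≤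
      exp 1 * (∑ j ∈ s, sSup (φ 0 '' Icc (j : ℝ) (j + 1)) *
        gaussianProfile k (-1) (j + 1/2) T x₁) + δ * (exp T * gaussianProfile k 2 0 T x₁) := by
  intro δ hδ
  set S : ℤ → ℝ := fun j => sSup (φ 0 '' Icc (j : ℝ) (j + 1))
  have hS : ∀ j, 0 ≤ S j := fun j =>
    Real.sSup_nonneg (by rintro _ ⟨y, -, rfl⟩; exact hnonneg 0 (by simp) y)
  have hφS : ∀ y : ℝ, φ 0 y ≤ S ⌊y⌋ := fun y =>
    le_csSup (isCompact_Icc.image hφ₀).bddAbove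
      ⟨y, ⟨Int.floor_le y, (Int.lt_floor_add_one y).le⟩, rfl⟩
  obtain ⟨N, hN, hxN⟩ : ∃ N : ℕ, M ≤ δ * exp (k / 16 * (N : ℝ) ^ 2) ∧ |x₁| ≤ N := by
    have hlim : Filter.Tendsto (fun N : ℕ => δ * exp (k / 16 * (N : ℝ) ^ 2))
        Filter.atTop Filter.atTop :=
      (tendsto_exp_atTop.comp (((Filter.tendsto_pow_atTop two_ne_zero).comp
        tendsto_natCast_atTop_atTop).const_mul_atTop (by positivity))).const_mul_atTop hδ
    exact ((hlim.eventually_ge_atTop M).and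
      (tendsto_natCast_atTop_atTop.eventually_ge_atTop |x₁|)).exists
  have hσ₁ : ∀ t ∈ Icc 0 T, (-1:ℝ) - t ≠ 0 := fun t ht => by linarith [ht.1]
  have hσ₂ : ∀ t ∈ Icc 0 T, (2:ℝ) - t ≠ 0 := fun t ht => by linarith [ht.2, hT.2]
  have hle1 : ∀ t ∈ Icc 0 T, t ∈ Icc (0:ℝ) 1 := fun t ht => ⟨ht.1, ht.2.trans hT.2.le⟩
  have hlateral : ∀ y : ℝ, y ^ 2 = (N : ℝ) ^ 2 → ∀ t ∈ Icc 0 T,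
      exp (-c * t) * φ t y - exp 1 * (∑ j ∈ Finset.Icc (-(N : ℤ)) N, S j *
        gaussianProfile k (-1) (j + 1/2) t y) - δ * (exp t * gaussianProfile k 2 0 t y) ≤ 0 := by
    intro y hy t ht
    have h1 : exp (-c * t) * φ t y ≤ δ * (exp t * gaussianProfile k 2 0 t y) := by
      calc exp (-c * t) * φ t y ≤ 1 * (M * exp (k / 16 * y ^ 2)) := by
            gcongr
            · exact hnonneg t (hle1 t ht) y
            · exact exp_le_one_iff.2 (by nlinarith [ht.1])
            · exact hgrow t (hle1 t ht) y
        _ ≤ δ * exp (k / 16 * y ^ 2) * exp (k / 16 * y ^ 2) := by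
            rw [one_mul, hy]
            gcongr
        _ = δ * (1 * exp (k * (y - 0) ^ 2 / 8)) := by
            rw [mul_assoc, ← exp_add, one_mul]
            ring_nf
        _ ≤ δ * (exp t * gaussianProfile k 2 0 t y) := by
            unfold gaussianProfile
            gcongr
            · exact one_le_exp ht.1
            · linarith [ht.2, hT.2]
            · linarith [ht.1]
    have h2 : 0 ≤ ∑ j ∈ Finset.Icc (-(N : ℤ)) N, S j * gaussianProfile k (-1) (j + 1/2) t y :=
      Finset.sum_nonneg fun j _ => mul_nonneg (hS j) (gaussianProfile_pos ..).le
    have h3 := mul_nonneg (exp_pos 1).le h2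
    linarith
  have hcomp := nonpos_of_strict_subsolution (T := T) (L := N) (a := a)
    (u := fun t y => exp (-c * t) * φ t y - exp 1 * (∑ j ∈ Finset.Icc (-(N : ℤ)) N, S j *
      gaussianProfile k (-1) (j + 1/2) t y) - δ * (exp t * gaussianProfile k 2 0 t y))
    (ut := fun t y => (exp (-c * t) * (-c) * φ t y + exp (-c * t) * pdT φ t y) -
      exp 1 * (∑ j ∈ Finset.Icc (-(N : ℤ)) N, S j * (gaussianProfile k (-1) (j + 1/2) t y *
        (k * (y - (j + 1/2)) ^ 2 / (4 * (-1 - t) ^ 2)))) -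
      δ * (exp t * gaussianProfile k 2 0 t y + exp t * (gaussianProfile k 2 0 t y *
        (k * (y - 0) ^ 2 / (4 * (2 - t) ^ 2)))))
    (ux := fun t y => exp (-c * t) * pdX φ t y -
      exp 1 * (∑ j ∈ Finset.Icc (-(N : ℤ)) N, S j * (gaussianProfile k (-1) (j + 1/2) t y *
        (k * (y - (j + 1/2)) / (2 * (-1 - t))))) -
      δ * (exp t * (gaussianProfile k 2 0 t y * (k * (y - 0) / (2 * (2 - t))))))
    (uxx := fun t y => exp (-c * t) * pdXX φ t y -
      exp 1 * (∑ j ∈ Finset.Icc (-(N : ℤ)) N, S j * (gaussianProfile k (-1) (j + 1/2) t y *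
        (k ^ 2 * (y - (j + 1/2)) ^ 2 / (4 * (-1 - t) ^ 2) + k / (2 * (-1 - t))))) -
      δ * (exp t * (gaussianProfile k 2 0 t y *
        (k ^ 2 * (y - 0) ^ 2 / (4 * (2 - t) ^ 2) + k / (2 * (2 - t))))))
    ?_ (fun t x => hk.le.trans (ha t x).1) ?_ ?_ ?_ ?_ ?_ (hlateral _ (by ring)) (hlateral _ rfl)
    T ⟨hT.1, le_rfl⟩ x₁ (abs_le.1 hxN)
  · exact ⟨_, by linarith [hcomp]⟩
  · have hφc := hcont.mono (prod_mono (fun t ht => hle1 t ht) (subset_univ (Icc (-(N:ℝ)) N)))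
    have hg₁ : ∀ j : ℤ, ContinuousOn (fun p : ℝ × ℝ =>
        gaussianProfile k (-1) (j + 1/2) p.1 p.2) (Icc 0 T ×ˢ Icc (-(N:ℝ)) N) :=
      fun j => continuousOn_gaussianProfile _ _ fun p hp => hσ₁ _ hp.1
    have hg₂ : ContinuousOn (fun p : ℝ × ℝ =>
        gaussianProfile k 2 0 p.1 p.2) (Icc 0 T ×ˢ Icc (-(N:ℝ)) N) :=
      continuousOn_gaussianProfile _ _ fun p hp => hσ₂ _ hp.1
    fun_prop
  · intro t ht y
    have ht' : t ∈ Icc 0 T := Ioc_subset_Icc_self ht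
    have h1 : HasDerivAt (fun s => exp (-c * s)) (exp (-c * t) * (-c)) t := by
      simpa using ((hasDerivAt_id t).const_mul (-c)).exp
    have h2 : HasDerivAt (fun s => φ s y) (pdT φ t y) t :=
      (((hdt y).differentiableOn one_ne_zero).differentiableAt
        (Ioc_mem_nhds ht.1 (ht.2.trans_lt hT.2))).hasDerivAt
    exact ((h1.mul h2).sub ((HasDerivAt.fun_sum fun (j : ℤ) _ =>
      (hasDerivAt_gaussianProfile_time k (-1) (j + 1/2) y (hσ₁ t ht')).const_mul (S j)).const_mul
        (exp 1))).sub
      (((Real.hasDerivAt_exp t).mul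
        (hasDerivAt_gaussianProfile_time k 2 0 y (hσ₂ t ht'))).const_mul δ)
  · intro t ht y
    have h2 : HasDerivAt (fun y => φ t y) (pdX φ t y) y :=
      ((hdx t ⟨ht.1, ht.2.trans hT.2.le⟩).differentiable two_ne_zero y).hasDerivAt
    exact ((h2.const_mul _).sub ((HasDerivAt.fun_sum fun (j : ℤ) _ =>
      (hasDerivAt_gaussianProfile_space k (-1) (j + 1/2) t y).const_mul (S j)).const_mul
        (exp 1))).sub
      (((hasDerivAt_gaussianProfile_space k 2 0 t y).const_mul (exp t)).const_mul δ)
  · intro t ht y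
    have h2 : HasDerivAt (fun y => pdX φ t y) (pdXX φ t y) y :=
      ((hdx t ⟨ht.1, ht.2.trans hT.2.le⟩).differentiable_deriv_two y).hasDerivAt
    exact ((h2.const_mul _).sub ((HasDerivAt.fun_sum fun (j : ℤ) _ =>
      (hasDerivAt_gaussianProfile_space_two k (-1) (j + 1/2) t y).const_mul (S j)).const_mul
        (exp 1))).sub
      (((hasDerivAt_gaussianProfile_space_two k 2 0 t y).const_mul (exp t)).const_mul δ)
  · intro t ht y
    have ha0 : 0 ≤ a t y := hk.le.trans (ha t y).1
    have hak : a t y * k ≤ 1 := by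
      calc a t y * k ≤ k⁻¹ * k := by gcongr; exact (ha t y).2
        _ = 1 := inv_mul_cancel₀ hk.ne'
    have hdecay : a t y * (∑ j ∈ Finset.Icc (-(N : ℤ)) N, S j *
        (gaussianProfile k (-1) (j + 1/2) t y *
          (k ^ 2 * (y - (j + 1/2)) ^ 2 / (4 * (-1 - t) ^ 2) + k / (2 * (-1 - t))))) ≤
        ∑ j ∈ Finset.Icc (-(N : ℤ)) N, S j * (gaussianProfile k (-1) (j + 1/2) t y *
          (k * (y - (j + 1/2)) ^ 2 / (4 * (-1 - t) ^ 2))) := by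
      rw [Finset.mul_sum]
      refine Finset.sum_le_sum fun j _ => ?_
      rw [mul_left_comm]
      refine mul_le_mul_of_nonneg_left ?_ (hS j)
      refine (gaussianProfile_supersolution hk hak _ _ _ _).trans ?_
      have : a t y * k / (2 * (-1 - t)) ≤ 0 :=
        div_nonpos_of_nonneg_of_nonpos (by positivity) (by linarith [ht.1])
      linarith [mul_nonpos_of_nonneg_of_nonpos
        (gaussianProfile_pos k (-1) (j + 1/2) t y).le this]
    have hgrowing := gaussianProfile_supersolution hk hak 2 0 t y
    have hg := gaussianProfile_pos k 2 0 t y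
    have hz : a t y * k / (2 * (2 - t)) < 1 := by
      rw [div_lt_one (by linarith [ht.2, hT.2])]
      linarith [ht.2, hT.2]
    have hstrict : a t y * (gaussianProfile k 2 0 t y *
        (k ^ 2 * (y - 0) ^ 2 / (4 * (2 - t) ^ 2) + k / (2 * (2 - t)))) <
        gaussianProfile k 2 0 t y + gaussianProfile k 2 0 t y *
          (k * (y - 0) ^ 2 / (4 * (2 - t) ^ 2)) := by
      linarith [mul_lt_of_lt_one_right hg hz]
    have h1 := mul_le_mul_of_nonneg_left hdecay (exp_pos 1).le
    have h2 := mul_lt_mul_of_pos_left hstrict (mul_pos hδ (exp_pos t))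
    rw [heq t ⟨ht.1, ht.2.trans hT.2.le⟩ y]
    linear_combination h1 + h2
  · intro y hy
    have hmem : ⌊y⌋ ∈ Finset.Icc (-(N : ℤ)) N := by
      rw [Finset.mem_Icc]
      refine ⟨Int.le_floor.2 (by simpa using hy.1), ?_⟩
      exact_mod_cast (Int.floor_le y).trans hy.2
    have h1 := Finset.single_le_sum
      (f := fun j : ℤ => S j * gaussianProfile k (-1) (j + 1/2) 0 y)
      (fun j _ => mul_nonneg (hS j) (gaussianProfile_pos ..).le) hmem
    have h2 : 1 ≤ exp 1 * gaussianProfile k (-1) (⌊y⌋ + 1/2) 0 y := by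
      rw [gaussianProfile, ← exp_add]
      refine one_le_exp ?_
      have h3 : (y - (⌊y⌋ + 1/2)) ^ 2 ≤ 1 := by
        have := Int.floor_le y
        have := Int.lt_floor_add_one y
        nlinarith
      have h4 : k * (y - (⌊y⌋ + 1/2)) ^ 2 ≤ 1 := mul_le_one₀ hk1 (sq_nonneg _) h3
      rw [show 4 * (-1 - (0:ℝ)) = -4 by norm_num]
      linarith
    have h5 : φ 0 y ≤ exp 1 * (∑ j ∈ Finset.Icc (-(N : ℤ)) N, S j *
        gaussianProfile k (-1) (j + 1/2) 0 y) := by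
      calc φ 0 y ≤ S ⌊y⌋ * 1 := by simpa using hφS y
        _ ≤ S ⌊y⌋ * (exp 1 * gaussianProfile k (-1) (⌊y⌋ + 1/2) 0 y) :=
          mul_le_mul_of_nonneg_left h2 (hS _)
        _ = exp 1 * (S ⌊y⌋ * gaussianProfile k (-1) (⌊y⌋ + 1/2) 0 y) := by ring
        _ ≤ _ := by gcongr
    have h6 : 0 < δ * (exp 0 * gaussianProfile k 2 0 0 y) :=
      mul_pos hδ (mul_pos (exp_pos _) (gaussianProfile_pos ..))
    simp only [mul_zero, exp_zero, one_mul] at h6 ⊢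
    linarith

/-- Gaussian-sum upper bound for positive solutions of the transformed equation
`∂ₜφ = κ(−∂ₓφ/(λφ)) ∂ₓ²φ + λc₂φ` with sub-inverse-Gaussian growth: for `t ∈ [0,1]`,
`φ(t,x) ≤ C ∑_{j ∈ ℤ} φ_j e^{−C⁻¹(x−j−1/2)²}` where `φ_j = sup_{[j,j+1]} φ(0,·)`,
with `C` depending only on `κ₀`, `λ`, and `c₂`. -/
theorem gaussian_sum_bound
    (κ₀ lam c₂ : ℝ) (hκ₀ : κ₀ ∈ Ioc (0:ℝ) 1) (hlam : 0 < lam) (hc₂ : 0 ≤ c₂) :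
    ∃ C : ℝ, 0 < C ∧
      ∀ (κ : ℝ → ℝ), Continuous κ → (∀ s : ℝ, κ s ∈ Icc κ₀ κ₀⁻¹) →
      ∀ φ : ℝ → ℝ → ℝ,
        ContinuousOn (fun p : ℝ × ℝ => φ p.1 p.2) (Icc 0 1 ×ˢ (univ : Set ℝ)) →
        (∀ t ∈ Ioc (0:ℝ) 1, ∀ x : ℝ, 0 < φ t x) →
        (∀ x : ℝ, ContDiffOn ℝ 1 (fun s => φ s x) (Ioc 0 1)) →
        (∀ t ∈ Ioc (0:ℝ) 1, ContDiff ℝ 2 (fun y => φ t y)) →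
        (∀ t ∈ Ioc (0:ℝ) 1, ∀ x : ℝ,
          pdT φ t x = κ (-(pdX φ t x) / (lam * φ t x)) * pdXX φ t x + lam * c₂ * φ t x) →
        (∃ K α : ℝ, 0 < K ∧ α < 2 ∧ ∀ t ∈ Icc (0:ℝ) 1, ∀ x : ℝ,
          0 ≤ φ t x ∧ φ t x ≤ K * Real.exp (K * |x| ^ α)) →
        ∀ t ∈ Icc (0:ℝ) 1, ∀ x : ℝ,
          φ t x ≤ C * ∑' j : ℤ,
            sSup (φ 0 '' Icc (j : ℝ) (j + 1)) * Real.exp (-C⁻¹ * (x - j - 1/2) ^ 2) := by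
  obtain ⟨hk, hk1⟩ := hκ₀
  set C : ℝ := exp (lam * c₂ + 1) + 8 / κ₀ with hC
  have hCpos : 0 < C := by positivity
  refine ⟨C, hCpos, ?_⟩
  rintro κ - hκ φ hcont - hdt hdx heq ⟨K, α, hK, hα, hbd⟩
  have hφ₀ : ∀ x, 0 ≤ φ 0 x := fun x => (hbd 0 (by simp) x).1
  have hφ₀c : Continuous (φ 0) := by
    rw [← continuousOn_univ]
    exact hcont.comp (f := fun x : ℝ => ((0:ℝ), x)) (by fun_prop) fun x _ => by simp
  obtain ⟨M, hM, hgrow⟩ := exists_le_mul_exp_sq hK hα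
    (by positivity : 0 < C⁻¹ / 4) hcont fun t ht x => (hbd t ht x).2
  obtain ⟨M', -, hgrow'⟩ := exists_le_mul_exp_sq hK hα
    (by positivity : 0 < κ₀ / 16) hcont fun t ht x => (hbd t ht x).2
  have hsum := summable_sSup_mul_exp (inv_pos.2 hCpos) hM hφ₀ (hgrow 0 (by simp))
  have hS : ∀ j : ℤ, 0 ≤ sSup (φ 0 '' Icc (j : ℝ) (j + 1)) := fun j =>
    Real.sSup_nonneg (by rintro _ ⟨y, -, rfl⟩; exact hφ₀ y)
  have hrate : C⁻¹ ≤ κ₀ / 8 := by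
    rw [← inv_div]
    exact inv_anti₀ (by positivity) (le_add_of_nonneg_left (exp_pos _).le)
  have hlt : ∀ t ∈ Ico (0:ℝ) 1, ∀ x : ℝ, φ t x ≤ C * ∑' j : ℤ,
      sSup (φ 0 '' Icc (j : ℝ) (j + 1)) * exp (-C⁻¹ * (x - j - 1/2) ^ 2) := by
    intro t ht x
    have hmain := exp_neg_mul_le_sum_gaussianProfile_of_lt_one hk hk1 (mul_nonneg hlam.le hc₂)
      (a := fun t x => κ (-(pdX φ t x) / (lam * φ t x))) (fun t x => hκ _) hcont hdt hdx heq
      (fun t ht x => (hbd t ht x).1) hgrow' hφ₀c ht x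
    have hfin : ∀ s : Finset ℤ, ∑ j ∈ s, sSup (φ 0 '' Icc (j : ℝ) (j + 1)) *
        gaussianProfile κ₀ (-1) (j + 1/2) t x ≤ ∑' j : ℤ,
        sSup (φ 0 '' Icc (j : ℝ) (j + 1)) * exp (-C⁻¹ * (x - j - 1/2) ^ 2) := by
      intro s
      refine (Finset.sum_le_sum fun j _ => ?_).trans
        ((hsum x).sum_le_tsum s fun j _ => mul_nonneg (hS j) (exp_pos _).le)
      refine mul_le_mul_of_nonneg_left (exp_le_exp.2 ?_) (hS j)
      have h1 : κ₀ / 8 ≤ κ₀ / (4 * (1 + t)) := by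
        have := ht.1
        have := ht.2
        gcongr
        linarith
      calc κ₀ * (x - (j + 1/2)) ^ 2 / (4 * (-1 - t))
          = -(κ₀ / (4 * (1 + t)) * (x - j - 1/2) ^ 2) := by
            rw [show 4 * (-1 - t) = -(4 * (1 + t)) by ring, div_neg]
            ring
        _ ≤ -(C⁻¹ * (x - j - 1/2) ^ 2) := by
            gcongr
            exact hrate.trans h1
        _ = _ := by ring
    have hlim : exp (-(lam * c₂) * t) * φ t x ≤ exp 1 * ∑' j : ℤ,
        sSup (φ 0 '' Icc (j : ℝ) (j + 1)) * exp (-C⁻¹ * (x - j - 1/2) ^ 2) := by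
      have hw : 0 < exp t * gaussianProfile κ₀ 2 0 t x :=
        mul_pos (exp_pos _) (gaussianProfile_pos ..)
      refine le_of_forall_pos_le_add fun η hη => ?_
      obtain ⟨s, hs⟩ := hmain _ (div_pos hη hw)
      rw [div_mul_cancel₀ _ hw.ne'] at hs
      refine hs.trans ?_
      gcongr
      exact hfin s
    have hT : 0 ≤ ∑' j : ℤ,
        sSup (φ 0 '' Icc (j : ℝ) (j + 1)) * exp (-C⁻¹ * (x - j - 1/2) ^ 2) :=
      tsum_nonneg fun j => mul_nonneg (hS j) (exp_pos _).le
    have hct : lam * c₂ * t ≤ lam * c₂ := mul_le_of_le_one_right (by positivity) ht.2.le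
    calc φ t x = exp (lam * c₂ * t) * (exp (-(lam * c₂) * t) * φ t x) := by
          rw [← mul_assoc, ← exp_add]
          simp
      _ ≤ exp (lam * c₂ * t) * (exp 1 * _) := by gcongr
      _ = exp (lam * c₂ * t + 1) * _ := by rw [← mul_assoc, ← exp_add]
      _ ≤ C * _ := by
          gcongr
          exact (exp_le_exp.2 (by linarith)).trans (le_add_of_nonneg_right (by positivity))
  intro t ht x
  rcases ht.2.lt_or_eq with h | rfl
  · exact hlt t ⟨ht.1, h⟩ x
  · have hc : ContinuousWithinAt (fun s => φ s x) (Ico 0 1) 1 := by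
      have := (hcont.comp (f := fun s : ℝ => (s, x)) (s := Icc 0 1) (by fun_prop)
        fun s hs => ⟨hs, mem_univ _⟩) 1 (by simp)
      exact this.mono Ico_subset_Icc_self
    have : (nhdsWithin (1:ℝ) (Ico 0 1)).NeBot := by
      rw [← mem_closure_iff_nhdsWithin_neBot, closure_Ico zero_ne_one]
      simp
    exact le_of_tendsto hc (eventually_mem_nhdsWithin.mono fun s hs => hlt s hs x)
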